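/- Let k ≥ 2, 1 ≤ a ≤ k−1, m ≥ 1, and let V^λ be an irreducible highest weight U_q(sl_k)-module with highest weight λ = mω_a and highest weight vector v_λ. Then for all 0 ≤ j ≤ m: (i) if a ≥ 2, then f_{a−1}^{(j+1)} f_a^{(j)} v_λ = 0; and (ii) if a ≤ k−2, then f_a^{(m−j+1)} f_{a+1}^{(j)} f_a^{(j)} v_λ = 0. -/

import Mathlib

/-!
Common setup: the quantum group `U_q(sl_k)` (presented by generators
`e_i, f_i, K_i = q^{h_i}, K_i⁻¹` for `1 ≤ i ≤ k-1` and the standard relations)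
over the field `KK = ℚ(q)`, and the notion of an irreducible highest weight
module.  Weights are recorded as functions `μ : ℕ → ℤ`, `μ i` being the value
`μ(h_i)` on the `i`-th simple coroot.
-/

noncomputable section
namespace QSL

abbrev KK : Type := RatFunc ℚ

/-- the variable `q`. -/
def qv : KK := RatFunc.X

/-- the quantum integer `[n]_q = (qⁿ - q⁻ⁿ)/(q - q⁻¹)`. -/
def qInt (n : ℕ) : KK := (qv ^ n - qv⁻¹ ^ n) / (qv - qv⁻¹)

/-- the quantum factorial `[n]_q!`. -/
def qFact : ℕ → KK
  | 0 => 1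
  | n + 1 => qFact n * qInt (n + 1)

/-- the Gaussian binomial coefficient `[m choose j]_q`. -/
def qBinom (m j : ℕ) : KK :=
  (∏ t ∈ Finset.range j, qInt (m - t)) / (∏ t ∈ Finset.range j, qInt (j - t))

/-- the Cartan matrix of `sl`:  `cartan i j = αⱼ(h_i)`. -/
def cartan (i j : ℕ) : ℤ := if i = j then 2 else if i + 1 = j ∨ j + 1 = i then -1 else 0

/-- The quantum group with `d` nodes (`d = k - 1` for `U_q(sl_k)`): a unital
associative `ℚ(q)`-algebra generated by elements `e i, f i, K i, Kinv i`
(`1 ≤ i ≤ d`, where `K i = q^{h_i}`) subject to the standard relations. -/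
structure QGroup (d : ℕ) where
  U : Type
  [ring : Ring U]
  [alg : Algebra KK U]
  e : ℕ → U
  f : ℕ → U
  K : ℕ → U
  Kinv : ℕ → U
  K_mul_Kinv : ∀ i, 1 ≤ i → i ≤ d → K i * Kinv i = 1
  Kinv_mul_K : ∀ i, 1 ≤ i → i ≤ d → Kinv i * K i = 1
  K_comm : ∀ i j, 1 ≤ i → i ≤ d → 1 ≤ j → j ≤ d → K i * K j = K j * K i
  K_e_Kinv : ∀ i j, 1 ≤ i → i ≤ d → 1 ≤ j → j ≤ d →
      K i * e j * Kinv i = (qv ^ cartan i j) • e j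
  K_f_Kinv : ∀ i j, 1 ≤ i → i ≤ d → 1 ≤ j → j ≤ d →
      K i * f j * Kinv i = (qv ^ (-cartan i j)) • f j
  e_f_comm : ∀ i j, 1 ≤ i → i ≤ d → 1 ≤ j → j ≤ d →
      e i * f j - f j * e i = if i = j then (qv - qv⁻¹)⁻¹ • (K i - Kinv i) else 0
  serre_e : ∀ i j, 1 ≤ i → i ≤ d → 1 ≤ j → j ≤ d → (i + 1 = j ∨ j + 1 = i) →
      e i * e i * e j - (qv + qv⁻¹) • (e i * e j * e i) + e j * e i * e i = 0
  serre_f : ∀ i j, 1 ≤ i → i ≤ d → 1 ≤ j → j ≤ d → (i + 1 = j ∨ j + 1 = i) →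
      f i * f i * f j - (qv + qv⁻¹) • (f i * f j * f i) + f j * f i * f i = 0
  comm_e : ∀ i j, 1 ≤ i → i ≤ d → 1 ≤ j → j ≤ d → (i + 1 < j ∨ j + 1 < i) →
      e i * e j = e j * e i
  comm_f : ∀ i j, 1 ≤ i → i ≤ d → 1 ≤ j → j ≤ d → (i + 1 < j ∨ j + 1 < i) →
      f i * f j = f j * f i
  gen : ∀ x : U, x ∈ Algebra.adjoin KK
      {y : U | ∃ i, 1 ≤ i ∧ i ≤ d ∧ (y = e i ∨ y = f i ∨ y = K i ∨ y = Kinv i)}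

attribute [instance] QGroup.ring QGroup.alg

variable {d : ℕ} (G : QGroup d)

/-- the divided power `f_i^{(n)} = f_iⁿ/[n]_q!`. -/
def fDiv (i n : ℕ) : G.U := (qFact n)⁻¹ • (G.f i) ^ n

/-- the divided power `e_i^{(n)} = e_iⁿ/[n]_q!`. -/
def eDiv (i n : ℕ) : G.U := (qFact n)⁻¹ • (G.e i) ^ n

variable {V : Type} [AddCommGroup V] [Module KK V] [Module G.U V] [IsScalarTower KK G.U V]

/-- `u` is a weight vector of weight `μ` (recorded via `μ i = μ(h_i)`). -/
def IsWtVec (u : V) (μ : ℕ → ℤ) : Prop :=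
  ∀ i, 1 ≤ i → i ≤ d → G.K i • u = (qv ^ μ i) • u

/-- `V` is an irreducible highest weight module over `G` with highest weight
`lam` and highest weight vector `v`: it is finite dimensional over `ℚ(q)`,
has a weight space decomposition, `v` is a nonzero weight vector of weight
`lam` annihilated by the `e_i`, `V` is generated by `v`, and `V` is
irreducible. -/
structure IsHWModule (lam : ℕ → ℤ) (v : V) : Prop where
  findim : FiniteDimensional KK V
  ne_zero : v ≠ 0
  wt : IsWtVec G v lam
  hw : ∀ i, 1 ≤ i → i ≤ d → G.e i • v = 0
  gen : ∀ w : V, ∃ p : G.U, p • v = w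
  irred : ∀ W : Submodule G.U V, W = ⊥ ∨ W = ⊤
  decomp : Submodule.span KK {u : V | ∃ μ : ℕ → ℤ, IsWtVec G u μ} = ⊤

/-- the weight `m ω_a`. -/
def omWt (a m : ℕ) : ℕ → ℤ := fun i => if i = a then (m : ℤ) else 0

/-- the weight `j ω_{a-1} + (m - j) ω_a`. -/
def hookWt (a m j : ℕ) : ℕ → ℤ := fun i =>
  (if i = a - 1 then (j : ℤ) else 0) + (if i = a then (m : ℤ) - (j : ℤ) else 0)

/-- `f_{a'}^{(c_{a'})} ⋯ f_{a+1}^{(c_{a+1})} f_a^{(c_a)} • v`. -/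
def fDivChain (c : ℕ → ℕ) (a a' : ℕ) (v : V) : V :=
  (List.range (a' + 1 - a)).foldl (fun u r => fDiv G (a + r) (c (a + r)) • u) v

lemma qv_ne_zero : qv ≠ 0 := RatFunc.X_ne_zero

lemma qv_pow_ne_one {n : ℕ} (hn : n ≠ 0) : qv ^ n ≠ 1 := by
  intro h
  have h' : algebraMap (Polynomial ℚ) (RatFunc ℚ) (Polynomial.X ^ n) =
      algebraMap (Polynomial ℚ) (RatFunc ℚ) 1 := by
    rw [map_pow, RatFunc.algebraMap_X, map_one]
    exact h
  have hdeg := congrArg Polynomial.natDegree (RatFunc.algebraMap_injective ℚ h')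
  rw [Polynomial.natDegree_X_pow, Polynomial.natDegree_one] at hdeg
  exact hn hdeg

lemma qv_zpow_ne_one {z : ℤ} (hz : z ≠ 0) : qv ^ z ≠ 1 := by
  intro h
  obtain ⟨n, rfl | rfl⟩ := z.eq_nat_or_neg
  · rw [zpow_natCast] at h
    exact qv_pow_ne_one (by omega) h
  · rw [zpow_neg, inv_eq_one, zpow_natCast] at h
    exact qv_pow_ne_one (by omega) h

lemma qv_zpow_injective : Function.Injective fun z : ℤ => qv ^ z := by
  intro y z h
  by_contra hne
  refine qv_zpow_ne_one (sub_ne_zero.mpr hne) ?_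
  rw [zpow_sub₀ qv_ne_zero]
  exact (div_eq_one_iff_eq (zpow_ne_zero z qv_ne_zero)).mpr h

/-- `q^z - q^{-z}`. -/
def qDiff (z : ℤ) : KK := qv ^ z - qv ^ (-z)

lemma qDiff_ne_zero {z : ℤ} (hz : z ≠ 0) : qDiff z ≠ 0 := by
  intro h
  have := qv_zpow_injective (sub_eq_zero.mp h)
  omega

lemma qDiff_one : qDiff 1 = qv - qv⁻¹ := by simp [qDiff]

lemma qDiff_mul_succ (n p : ℤ) :
    qDiff (p + 1) * qDiff (n - p) =
      qDiff p * qDiff (n - p + 1) + qDiff (n - 2 * p) * qDiff 1 := by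
  have hq := qv_ne_zero
  have hp : qv ^ p ≠ 0 := zpow_ne_zero p hq
  have hn : qv ^ n ≠ 0 := zpow_ne_zero n hq
  have h2 : qv ^ (2 * p) = (qv ^ p) ^ 2 := by rw [mul_comm, zpow_mul]; norm_cast
  simp only [qDiff, zpow_neg, zpow_add₀ hq, zpow_sub₀ hq, h2, zpow_one]
  field_simp
  ring

section Action

variable {i j : ℕ} {x : V}

lemma K_smul_f_smul (hi : 1 ≤ i) (hid : i ≤ d) (hj : 1 ≤ j) (hjd : j ≤ d) (x : V) :
    G.K i • G.f j • x = (qv ^ (-cartan i j)) • G.f j • G.K i • x := by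
  have h : G.K i * G.f j = (qv ^ (-cartan i j)) • (G.f j * G.K i) := by
    rw [← smul_mul_assoc, ← G.K_f_Kinv i j hi hid hj hjd, mul_assoc, mul_assoc,
      G.Kinv_mul_K i hi hid, mul_one]
  rw [← mul_smul, h, smul_assoc, mul_smul]

lemma K_smul_f_pow_smul (hi : 1 ≤ i) (hid : i ≤ d) (hj : 1 ≤ j) (hjd : j ≤ d) {n : ℤ}
    (hx : G.K i • x = (qv ^ n) • x) (p : ℕ) :
    G.K i • (G.f j ^ p • x) = (qv ^ (n - p * cartan i j)) • (G.f j ^ p • x) := by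
  induction p with
  | zero => simpa using hx
  | succ p ih =>
    rw [pow_succ', mul_smul, K_smul_f_smul G hi hid hj hjd, ih, smul_comm (G.f j) (_ : KK),
      smul_smul, ← zpow_add₀ qv_ne_zero]
    congr 2
    push_cast
    ring

lemma Kinv_smul_eq (hi : 1 ≤ i) (hid : i ≤ d) {n : ℤ} (hx : G.K i • x = (qv ^ n) • x) :
    G.Kinv i • x = (qv ^ (-n)) • x := by
  have h : x = (qv ^ n) • (G.Kinv i • x) := by
    rw [smul_comm (_ : KK) (G.Kinv i), ← hx, ← mul_smul, G.Kinv_mul_K i hi hid, one_smul]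
  conv_rhs => rw [h]
  rw [smul_smul, ← zpow_add₀ qv_ne_zero, neg_add_cancel, zpow_zero, one_smul]

lemma e_smul_f_smul_same (hi : 1 ≤ i) (hid : i ≤ d) {n : ℤ} (hx : G.K i • x = (qv ^ n) • x) :
    G.e i • G.f i • x = G.f i • G.e i • x + (qDiff n / qDiff 1) • x := by
  have h := G.e_f_comm i i hi hid hi hid
  rw [if_pos rfl, sub_eq_iff_eq_add'] at h
  rw [← mul_smul, h, add_smul, smul_assoc, sub_smul, hx, Kinv_smul_eq G hi hid hx,
    ← sub_smul, smul_smul (_ : KK), mul_smul, qDiff_one, div_eq_inv_mul]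
  rfl

lemma commute_e_f_pow (hi : 1 ≤ i) (hid : i ≤ d) (hj : 1 ≤ j) (hjd : j ≤ d)
    (hij : i ≠ j) (p : ℕ) : Commute (G.e i) (G.f j ^ p) := by
  have h := G.e_f_comm i j hi hid hj hjd
  rw [if_neg hij, sub_eq_zero] at h
  exact Commute.pow_right h p

/-- The `U_q(sl_2)` relation `e f^{p+1} x = [p+1] [n-p] f^p x` on a vector `x` of weight `n`
killed by `e`. -/
lemma e_smul_f_pow_succ_smul (hi : 1 ≤ i) (hid : i ≤ d) {n : ℤ}
    (hx : G.K i • x = (qv ^ n) • x) (he : G.e i • x = 0) (p : ℕ) :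
    G.e i • (G.f i ^ (p + 1) • x) =
      (qDiff (p + 1) * qDiff (n - p) / qDiff 1 ^ 2) • (G.f i ^ p • x) := by
  have h1 : qDiff 1 ≠ 0 := qDiff_ne_zero one_ne_zero
  have hK := K_smul_f_pow_smul G hi hid hi hid hx
  induction p with
  | zero =>
    have := e_smul_f_smul_same G hi hid hx
    rw [he, smul_zero, zero_add] at this
    rw [zero_add, pow_one, this, pow_zero, one_smul]
    congr 1
    simp only [Nat.cast_zero, zero_add, sub_zero]
    field_simp
  | succ p ih =>
    rw [pow_succ', mul_smul, e_smul_f_smul_same G hi hid (hK (p + 1)), ih,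
      smul_comm (G.f i) (_ : KK), ← mul_smul (G.f i), ← pow_succ', ← add_smul]
    congr 1
    rw [qDiff_mul_succ n (p + 1 : ℕ)]
    have hc : cartan i i = 2 := if_pos rfl
    have e1 : n - ((p + 1 : ℕ) : ℤ) + 1 = n - p := by push_cast; ring
    rw [hc, e1, mul_comm (2 : ℤ), Nat.cast_succ]
    field_simp

/-- In a finite-dimensional module, a vector of `h_i`-weight `n` killed by `e_i` is killed by
`f_i^{n+1}`. -/
lemma f_pow_succ_smul_eq_zero [FiniteDimensional KK V] (hi : 1 ≤ i) (hid : i ≤ d) {n : ℕ}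
    (hx : G.K i • x = (qv ^ (n : ℤ)) • x) (he : G.e i • x = 0) :
    G.f i ^ (n + 1) • x = 0 := by
  by_contra hne
  have hup : ∀ p, G.f i ^ (n + 1 + p) • x ≠ 0 := by
    intro p
    induction p with
    | zero => exact hne
    | succ p ih =>
      intro h0
      have h := e_smul_f_pow_succ_smul G hi hid hx he (n + 1 + p)
      rw [show n + 1 + p + 1 = n + 1 + (p + 1) by ring, h0, smul_zero] at h
      refine (smul_ne_zero (div_ne_zero (mul_ne_zero ?_ ?_) ?_) ih) h.symm
      · exact qDiff_ne_zero (by omega)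
      · exact qDiff_ne_zero (by push_cast; omega)
      · exact pow_ne_zero 2 (qDiff_ne_zero one_ne_zero)
  let T : Module.End KK V := LinearMap.restrictScalars KK (Algebra.lsmul KK KK V (G.K i))
  have hinj : Function.Injective
      fun p : ℕ => qv ^ ((n : ℤ) - ((n + 1 + p : ℕ) : ℤ) * cartan i i) := by
    intro p p' h
    have hc : cartan i i = 2 := if_pos rfl
    have := qv_zpow_injective h
    rw [hc] at this
    push_cast at this
    omega
  have hli := Module.End.eigenvectors_linearIndependent' T _ hinj
    (fun p => G.f i ^ (n + 1 + p) • x)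
    fun p => Module.End.hasEigenvector_iff.mpr
      ⟨Module.End.mem_eigenspace_iff.mpr (K_smul_f_pow_smul G hi hid hi hid hx _), hup p⟩
  exact not_finite_iff_infinite.mpr inferInstance hli.finite

end Action

/-- Proposition `tech` (4) and (5):  for `λ = m ω_a` and
`0 ≤ j ≤ m`:  (i) if `a ≥ 2` then `f_{a-1}^{(j+1)} f_a^{(j)} v_λ = 0`; and
(ii) if `a ≤ k - 2` then `f_a^{(m-j+1)} f_{a+1}^{(j)} f_a^{(j)} v_λ = 0`. -/
theorem divided_power_vanishing_bounds
    (k a m j : ℕ) (hk : 2 ≤ k) (ha : 1 ≤ a) (hak : a ≤ k - 1) (hm : 1 ≤ m)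
    (hj : j ≤ m)
    (G : QGroup (k - 1)) (V : Type) [AddCommGroup V] [Module KK V] [Module G.U V]
    [IsScalarTower KK G.U V]
    (v : V) (hV : IsHWModule G (omWt a m) v) :
    (2 ≤ a → fDiv G (a - 1) (j + 1) • (fDiv G a j • v) = 0) ∧
    (a ≤ k - 2 →
      fDiv G a (m - j + 1) • (fDiv G (a + 1) j • (fDiv G a j • v)) = 0) := by
  have := hV.findim
  have hwt : ∀ i, 1 ≤ i → i ≤ k - 1 → G.K i • v = (qv ^ omWt a m i) • v := hV.wt
  have hlow : ∀ i p, 1 ≤ i → i ≤ k - 1 → (i + 1 = a ∨ a + 1 = i) →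
      G.f i ^ (p + 1) • G.f a ^ p • v = 0 := by
    intro i p hi hik hia
    have hne : i ≠ a := by omega
    refine f_pow_succ_smul_eq_zero G hi hik ?_ ?_
    · rw [K_smul_f_pow_smul G hi hik ha hak (hwt i hi hik) p]
      simp [omWt, cartan, hne, hia]
    · rw [← mul_smul, (commute_e_f_pow G hi hik ha hak hne p).eq, mul_smul, hV.hw i hi hik, smul_zero]
  have hdiv : ∀ i n (x : V), fDiv G i n • x = (qFact n)⁻¹ • G.f i ^ n • x :=
    fun i n x => smul_assoc _ _ _
  simp only [hdiv, smul_comm (_ : G.U) (_ : KK)]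
  refine ⟨fun ha2 => ?_, fun hak2 => ?_⟩
  · rw [hlow (a - 1) j (by omega) (by omega) (by omega)]
    simp only [smul_zero]
  · have hb : 1 ≤ a + 1 := by omega
    have hbk : a + 1 ≤ k - 1 := by omega
    have key : G.f a ^ (m - j + 1) • G.f (a + 1) ^ j • G.f a ^ j • v = 0 := by
      refine f_pow_succ_smul_eq_zero G ha hak ?_ ?_
      · have h1 := K_smul_f_pow_smul G ha hak ha hak (hwt a ha hak) j
        rw [K_smul_f_pow_smul G ha hak hb hbk h1 j]
        congr 2
        simp only [omWt, cartan, if_true, true_or, if_neg (Nat.ne_of_lt (Nat.lt_succ_self a))]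
        omega
      · rw [← mul_smul, (commute_e_f_pow G ha hak hb hbk (by omega) j).eq, mul_smul]
        cases j with
        | zero => simp [hV.hw a ha hak]
        | succ p =>
          rw [e_smul_f_pow_succ_smul G ha hak (hwt a ha hak) (hV.hw a ha hak),
            smul_comm (_ : G.U) (_ : KK), hlow (a + 1) p hb hbk (Or.inr rfl), smul_zero]
    rw [key]
    simp only [smul_zero]

end QSL
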